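/- arXiv:2303.07589 — 3 statements merged into one kernel-verified Lean document; each statement's English description precedes it below -/
import Mathlib

section
/- Let λ_PP, λ_BP, λ_NP, λ_PN, λ_BN, λ_NN be real decision costs satisfying 0 ≤ λ_PP < λ_BP < λ_NP, 0 ≤ λ_NN < λ_BN < λ_PN, and the product condition (λ_BN − λ_NN)·(λ_BP − λ_PP) < (λ_PN − λ_BN)·(λ_NP − λ_BP). Then the thresholds α = (λ_PN − λ_BN)/((λ_PN − λ_BN) + (λ_BP − λ_PP)), β = (λ_BN − λ_NN)/((λ_BN − λ_NN) + (λ_NP − λ_BP)), and γ = (λ_PN − λ_NN)/((λ_PN − λ_NN) + (λ_NP − λ_PP)) satisfy 0 < β < γ < α < 1. -/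
/-- Under the standard cost conditions and the product condition, the
three-way decision thresholds satisfy `0 < β < γ < α < 1`. -/
theorem thresholds_ordered (lPP lBP lNP lPN lBN lNN : ℝ)
    (h1 : 0 ≤ lPP) (h2 : lPP < lBP) (h3 : lBP < lNP)
    (h4 : 0 ≤ lNN) (h5 : lNN < lBN) (h6 : lBN < lPN)
    (hprod : (lBN - lNN) * (lBP - lPP) < (lPN - lBN) * (lNP - lBP)) :
    0 < (lBN - lNN) / ((lBN - lNN) + (lNP - lBP)) ∧
    (lBN - lNN) / ((lBN - lNN) + (lNP - lBP)) <
      (lPN - lNN) / ((lPN - lNN) + (lNP - lPP)) ∧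
    (lPN - lNN) / ((lPN - lNN) + (lNP - lPP)) <
      (lPN - lBN) / ((lPN - lBN) + (lBP - lPP)) ∧
    (lPN - lBN) / ((lPN - lBN) + (lBP - lPP)) < 1 := by
  refine ⟨div_pos (by linarith) (by linarith), ?_, ?_, ?_⟩
  · rw [div_lt_div_iff₀ (by linarith) (by linarith)]
    linarith
  · rw [div_lt_div_iff₀ (by linarith) (by linarith)]
    linarith
  · rw [div_lt_one (by linarith)]
    linarith
end

section
/- Let λ_PP, λ_BP, λ_NP, λ_PN, λ_BN, λ_NN be real decision costs satisfying 0 ≤ λ_PP < λ_BP < λ_NP and 0 ≤ λ_NN < λ_BN < λ_PN, and let α, β, γ be the associated thresholds. Then the following are equivalent: (i) (λ_BN − λ_NN)·(λ_BP − λ_PP) < (λ_PN − λ_BN)·(λ_NP − λ_BP); (ii) β < α; (iii) β < γ; (iv) γ < α. -/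
/-- Comparing two fractions of the form `x / (x + y)` amounts to cross-multiplying the parts. -/
theorem div_add_lt_div_add_iff_mul_lt_mul {x y z w : ℝ}
    (hxy : 0 < x + y) (hzw : 0 < z + w) :
    x / (x + y) < z / (z + w) ↔ x * w < z * y := by
  rw [div_lt_div_iff₀ hxy hzw]
  constructor <;> intro h <;> linarith

/-- Under the standard cost conditions, the product condition, `β < α`,
`β < γ`, and `γ < α` are all equivalent. -/
theorem product_condition_tfae (lPP lBP lNP lPN lBN lNN : ℝ)
    (h1 : 0 ≤ lPP) (h2 : lPP < lBP) (h3 : lBP < lNP)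
    (h4 : 0 ≤ lNN) (h5 : lNN < lBN) (h6 : lBN < lPN) :
    List.TFAE
      [(lBN - lNN) * (lBP - lPP) < (lPN - lBN) * (lNP - lBP),
       (lBN - lNN) / ((lBN - lNN) + (lNP - lBP)) <
         (lPN - lBN) / ((lPN - lBN) + (lBP - lPP)),
       (lBN - lNN) / ((lBN - lNN) + (lNP - lBP)) <
         (lPN - lNN) / ((lPN - lNN) + (lNP - lPP)),
       (lPN - lNN) / ((lPN - lNN) + (lNP - lPP)) <
         (lPN - lBN) / ((lPN - lBN) + (lBP - lPP))] := by
  rw [div_add_lt_div_add_iff_mul_lt_mul (by linarith) (by linarith),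
    div_add_lt_div_add_iff_mul_lt_mul (by linarith) (by linarith),
    div_add_lt_div_add_iff_mul_lt_mul (by linarith) (by linarith)]
  tfae_have 1 ↔ 2 := Iff.rfl
  tfae_have 1 ↔ 3 := by constructor <;> intro h <;> linarith
  tfae_have 1 ↔ 4 := by constructor <;> intro h <;> linarith
  tfae_finish
end

section
/- Let λ_PP, λ_BP, λ_NP, λ_PN, λ_BN, λ_NN be real decision costs satisfying 0 ≤ λ_PP < λ_BP < λ_NP, 0 ≤ λ_NN < λ_BN < λ_PN, and (λ_BN − λ_NN)·(λ_BP − λ_PP) < (λ_PN − λ_BN)·(λ_NP − λ_BP), with associated thresholds α, β, γ and expected losses R_P(p) = λ_PP·p + λ_PN·(1−p), R_B(p) = λ_BP·p + λ_BN·(1−p), R_N(p) = λ_NP·p + λ_NN·(1−p). Then for every p ∈ [0,1]: (i) R_P(p) ≤ R_B(p) and R_P(p) ≤ R_N(p) hold simultaneously if and only if p ≥ α; (ii) R_N(p) ≤ R_P(p) and R_N(p) ≤ R_B(p) hold simultaneously if and only if p ≤ β; (iii) R_B(p) ≤ R_P(p) and R_B(p) ≤ R_N(p) hold simultaneously if and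 only if β ≤ p ≤ α. -/
/-- The action with costs `a` (positive) and `b` (negative) is at most as costly as the one with
costs `a'` and `b'` exactly when the probability is at least the associated threshold. -/
theorem expected_loss_le_iff_threshold_le {a b a' b' : ℝ} (ha : a < a') (hb : b' < b) (p : ℝ) :
    a * p + b * (1 - p) ≤ a' * p + b' * (1 - p) ↔ (b - b') / ((b - b') + (a' - a)) ≤ p := by
  rw [div_le_iff₀ (by linarith)]
  constructor <;> intro h <;> linarith

/-- The reverse comparison of expected losses holds exactly when the probability is at most the
associated threshold. -/
theorem expected_loss_le_iff_le_threshold {a b a' b' : ℝ} (ha : a < a') (hb : b' < b) (p : ℝ) :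
    a' * p + b' * (1 - p) ≤ a * p + b * (1 - p) ↔ p ≤ (b - b') / ((b - b') + (a' - a)) := by
  rw [le_div_iff₀ (by linarith)]
  constructor <;> intro h <;> linarith

/-- Bayes decision rules: accept iff `p ≥ α`, reject iff `p ≤ β`, and delay
iff `β ≤ p ≤ α`, where `α` and `β` are the three-way decision thresholds. -/
theorem bayes_decision_rules (lPP lBP lNP lPN lBN lNN : ℝ)
    (h1 : 0 ≤ lPP) (h2 : lPP < lBP) (h3 : lBP < lNP)
    (h4 : 0 ≤ lNN) (h5 : lNN < lBN) (h6 : lBN < lPN)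
    (hprod : (lBN - lNN) * (lBP - lPP) < (lPN - lBN) * (lNP - lBP)) :
    ∀ p : ℝ, 0 ≤ p → p ≤ 1 →
      ((lPP * p + lPN * (1 - p) ≤ lBP * p + lBN * (1 - p) ∧
        lPP * p + lPN * (1 - p) ≤ lNP * p + lNN * (1 - p)) ↔
        (lPN - lBN) / ((lPN - lBN) + (lBP - lPP)) ≤ p) ∧
      ((lNP * p + lNN * (1 - p) ≤ lPP * p + lPN * (1 - p) ∧
        lNP * p + lNN * (1 - p) ≤ lBP * p + lBN * (1 - p)) ↔
        p ≤ (lBN - lNN) / ((lBN - lNN) + (lNP - lBP))) ∧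
      ((lBP * p + lBN * (1 - p) ≤ lPP * p + lPN * (1 - p) ∧
        lBP * p + lBN * (1 - p) ≤ lNP * p + lNN * (1 - p)) ↔
        ((lBN - lNN) / ((lBN - lNN) + (lNP - lBP)) ≤ p ∧
         p ≤ (lPN - lBN) / ((lPN - lBN) + (lBP - lPP)))) := by
  intro p _ _
  have hthreshold : (lBN - lNN) / ((lBN - lNN) + (lNP - lBP)) <
      (lPN - lBN) / ((lPN - lBN) + (lBP - lPP)) := by
    rw [div_lt_div_iff₀ (by linarith) (by linarith)]
    linarith
  have hPB := expected_loss_le_iff_threshold_le h2 h6 p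
  have hBP := expected_loss_le_iff_le_threshold h2 h6 p
  have hBN := expected_loss_le_iff_threshold_le h3 h5 p
  have hNB := expected_loss_le_iff_le_threshold h3 h5 p
  refine ⟨⟨fun h => hPB.1 h.1, fun h => ?_⟩, ⟨fun h => hNB.1 h.2, fun h => ?_⟩, ?_⟩
  · have hP := hPB.2 h
    exact ⟨hP, hP.trans (hBN.2 (hthreshold.le.trans h))⟩
  · have hN := hNB.2 h
    exact ⟨hN.trans (hBP.2 (h.trans hthreshold.le)), hN⟩
  · rw [hBP, hBN, and_comm]
end
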